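/- Let (X,Y) be a (p+q)-dimensional multivariate normal random vector with covariance matrix Σ having block decomposition Σ = [[Σ_{11}, Σ_{12}], [Σ_{21}, Σ_{22}]], where Σ_{11} is p×p and Σ_{22} is q×q, and suppose each component of Y is non-degenerate. Then T(Y|X) = 1 if and only if rank(Σ) = rank(Σ_{11}). -/

import Mathlib

open MeasureTheory ProbabilityTheory

/-- Azadkia–Chatterjee's rank correlation `ξ(Y | m)` of a real random variable `Y`
given a sub-σ-algebra `m`. -/
noncomputable def xiSigma {Ω : Type*} (m : MeasurableSpace Ω) [MeasurableSpace Ω]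
    (P : Measure Ω) (Y : Ω → ℝ) : ℝ :=
  (∫ y, variance (P[Set.indicator {ω | y ≤ Y ω} (fun _ => (1 : ℝ)) | m]) P ∂(P.map Y)) /
  (∫ y, variance (Set.indicator {ω | y ≤ Y ω} (fun _ => (1 : ℝ))) P ∂(P.map Y))

/-- Azadkia–Chatterjee's rank correlation `ξ(Y | X)`: conditioning on the σ-algebra
generated by the random vector `X`. -/
noncomputable def xi {Ω α : Type*} [MeasurableSpace Ω] [MeasurableSpace α]
    (P : Measure Ω) (Y : Ω → ℝ) (X : Ω → α) : ℝ :=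
  xiSigma (MeasurableSpace.comap X inferInstance) P Y

/-- The σ-algebra generated by the response variables with index `< i`,
i.e. by `(Y_1, …, Y_{i-1})`; for `i = 0` it is the trivial σ-algebra `⊥`,
so that `xiSigma (sigmaPast Y 0) P (Y 0) = ξ(Y_1 | ∅) = 0`. -/
def sigmaPast {Ω : Type*} {q : ℕ} (Y : Fin q → Ω → ℝ) (i : Fin q) :
    MeasurableSpace Ω :=
  ⨆ j : Fin q, ⨆ _ : j < i, MeasurableSpace.comap (Y j) inferInstance

/-- The extension `T(Y | X)` of Azadkia–Chatterjee's rank correlation to a vector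
`Y = (Y_1, …, Y_q)` of response variables, given the predictor vector `X`:
`T(Y|X) = 1 − (q − ∑_i ξ(Y_i | (X,Y_{i−1},…,Y_1))) / (q − ∑_i ξ(Y_i | (Y_{i−1},…,Y_1)))`. -/
noncomputable def T {Ω α : Type*} [MeasurableSpace Ω] [MeasurableSpace α]
    (P : Measure Ω) {q : ℕ} (Y : Fin q → Ω → ℝ) (X : Ω → α) : ℝ :=
  1 - ((q : ℝ) - ∑ i, xiSigma (MeasurableSpace.comap X inferInstance ⊔ sigmaPast Y i) P (Y i)) /
      ((q : ℝ) - ∑ i, xiSigma (sigmaPast Y i) P (Y i))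

/-- A real random variable is non-degenerate if it is not almost surely constant. -/
def Nondegenerate {Ω : Type*} [MeasurableSpace Ω] (P : Measure Ω) (Y : Ω → ℝ) : Prop :=
  ¬ ∃ c : ℝ, ∀ᵐ ω ∂P, Y ω = c

open Matrix in
/-- `W` is a centered Gaussian random vector with covariance matrix `S`:
every linear combination `⟨a, W⟩` is a centered real Gaussian with variance `aᵀ S a`. -/
def IsCenteredGaussianVec {Ω : Type*} [MeasurableSpace Ω] (P : Measure Ω) {n : ℕ}
    (W : Ω → (Fin n → ℝ)) (S : Matrix (Fin n) (Fin n) ℝ) : Prop :=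
  ∀ a : Fin n → ℝ,
    P.map (fun ω => ∑ i, a i * W ω i) =
      gaussianReal 0 (Real.toNNReal (a ⬝ᵥ S.mulVec a))

open Matrix in
/-- `W` is a Gaussian random vector with mean vector `m` and covariance matrix `S`:
every linear combination `⟨a, W⟩` is a real Gaussian with mean `⟨a, m⟩` and
variance `aᵀ S a`. -/
def IsGaussianVec {Ω : Type*} [MeasurableSpace Ω] (P : Measure Ω) {n : ℕ}
    (W : Ω → (Fin n → ℝ)) (m : Fin n → ℝ) (S : Matrix (Fin n) (Fin n) ℝ) : Prop :=
  ∀ a : Fin n → ℝ,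
    P.map (fun ω => ∑ i, a i * W ω i) =
      gaussianReal (∑ i, a i * m i) (Real.toNNReal (a ⬝ᵥ S.mulVec a))

section RankCorrelation

variable {Ω : Type*} {m : MeasurableSpace Ω} [mΩ : MeasurableSpace Ω] {P : Measure Ω}
  [IsProbabilityMeasure P] {Y : Ω → ℝ}

lemma memLp_indicator_le (hY : Measurable Y) (y : ℝ) (r : ENNReal) :
    MemLp (Set.indicator {ω | y ≤ Y ω} (fun _ => (1 : ℝ))) r P :=
  (memLp_const 1).indicator (measurableSet_le measurable_const hY)

lemma memLp_condExp_indicator_le (hY : Measurable Y) (y : ℝ) :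
    MemLp (P[Set.indicator {ω | y ≤ Y ω} (fun _ => (1 : ℝ)) | m]) 2 P :=
  (memLp_indicator_le hY y 2).condExp one_le_two

lemma variance_condExp_indicator_le (hm : m ≤ mΩ) (hY : Measurable Y) (y : ℝ) :
    variance (P[Set.indicator {ω | y ≤ Y ω} (fun _ => (1 : ℝ)) | m]) P ≤
      variance (Set.indicator {ω | y ≤ Y ω} (fun _ => (1 : ℝ))) P := by
  rw [← integral_condVar_add_variance_condExp hm (memLp_indicator_le hY y 2)]
  have : 0 ≤ ∫ ω, (condVar m (Set.indicator {ω | y ≤ Y ω} (fun _ => (1 : ℝ))) P) ω ∂P := by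
    rw [condVar, integral_condExp hm]
    exact integral_nonneg fun ω => sq_nonneg _
  linarith

lemma condExp_indicator_ae_eq_self_iff (hm : m ≤ mΩ) (s : Set Ω) :
    P[Set.indicator s (fun _ => (1 : ℝ)) | m] =ᵐ[P] Set.indicator s (fun _ => (1 : ℝ)) ↔
      EventuallyMeasurableSet m (ae P) s := by
  constructor
  · intro h
    have ht : MeasurableSet[m] {ω | (P[Set.indicator s (fun _ => (1 : ℝ)) | m]) ω = 1} :=
      stronglyMeasurable_condExp.measurable (measurableSet_singleton 1)
    refine ⟨_, ht, ?_⟩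
    filter_upwards [h] with ω hω
    by_cases hωs : ω ∈ s
    · have : ω ∈ {ω | (P[Set.indicator s (fun _ => (1 : ℝ)) | m]) ω = 1} := by
        simp [hω, hωs]
      exact propext ⟨fun _ => this, fun _ => hωs⟩
    · have : ω ∉ {ω | (P[Set.indicator s (fun _ => (1 : ℝ)) | m]) ω = 1} := by
        simp [hω, hωs]
      exact propext ⟨fun h => absurd h hωs, fun h => absurd h this⟩
  · rintro ⟨t, ht, hst⟩
    have hind : Set.indicator s (fun _ => (1 : ℝ)) =ᵐ[P] Set.indicator t (fun _ => (1 : ℝ)) :=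
      indicator_ae_eq_of_ae_eq_set hst
    refine (condExp_congr_ae hind).trans (Filter.EventuallyEq.trans ?_ hind.symm)
    rw [condExp_of_stronglyMeasurable hm (stronglyMeasurable_const.indicator ht)]
    exact (integrable_const 1).indicator (hm _ ht)

lemma variance_condExp_indicator_eq_iff (hm : m ≤ mΩ) (hY : Measurable Y) (y : ℝ) :
    variance (P[Set.indicator {ω | y ≤ Y ω} (fun _ => (1 : ℝ)) | m]) P =
      variance (Set.indicator {ω | y ≤ Y ω} (fun _ => (1 : ℝ))) P ↔
    EventuallyMeasurableSet m (ae P) {ω | y ≤ Y ω} := by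
  rw [← condExp_indicator_ae_eq_self_iff hm,
    ← integral_condVar_add_variance_condExp hm (memLp_indicator_le hY y 2)]
  have hint := ((memLp_indicator_le (P := P) hY y 2).sub
    (memLp_condExp_indicator_le (m := m) hY y)).integrable_sq
  rw [right_eq_add, condVar, integral_condExp hm]
  refine (integral_eq_zero_iff_of_nonneg (fun ω => sq_nonneg _) hint).trans ?_
  refine ⟨fun h => ?_, fun h => ?_⟩ <;> filter_upwards [h] with ω hω
  · exact (sub_eq_zero.1 (pow_eq_zero_iff two_ne_zero |>.1 hω)).symm
  · simp [hω]

lemma antitone_integral_condExp_indicator_sq (hY : Measurable Y) :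
    Antitone fun y => ∫ ω, (P[Set.indicator {ω | y ≤ Y ω} (fun _ => (1 : ℝ)) | m]) ω ^ 2 ∂P := by
  intro y z hyz
  refine integral_mono_ae (memLp_condExp_indicator_le hY z).integrable_sq
    (memLp_condExp_indicator_le hY y).integrable_sq ?_
  have h0 : 0 ≤ᵐ[P] P[Set.indicator {ω | z ≤ Y ω} (fun _ => (1 : ℝ)) | m] :=
    condExp_nonneg (ae_of_all _ fun ω => Set.indicator_nonneg (fun _ _ => zero_le_one) ω)
  have h1 : P[Set.indicator {ω | z ≤ Y ω} (fun _ => (1 : ℝ)) | m] ≤ᵐ[P]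
      P[Set.indicator {ω | y ≤ Y ω} (fun _ => (1 : ℝ)) | m] := by
    refine condExp_mono ((memLp_indicator_le hY z 1).integrable le_rfl)
      ((memLp_indicator_le hY y 1).integrable le_rfl) (ae_of_all _ fun ω => ?_)
    exact Set.indicator_le_indicator_of_subset (fun ω hω => hyz.trans hω) (fun _ => zero_le_one) ω
  filter_upwards [h0, h1] with ω h0 h1
  exact pow_le_pow_left₀ h0 h1 2

lemma measurable_variance_condExp_indicator (hm : m ≤ mΩ) (hY : Measurable Y) :
    Measurable fun y =>
      variance (P[Set.indicator {ω | y ≤ Y ω} (fun _ => (1 : ℝ)) | m]) P := by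
  have h (y : ℝ) : variance (P[Set.indicator {ω | y ≤ Y ω} (fun _ => (1 : ℝ)) | m]) P =
      (∫ ω, (P[Set.indicator {ω | y ≤ Y ω} (fun _ => (1 : ℝ)) | m]) ω ^ 2 ∂P) -
        P.real {ω | y ≤ Y ω} ^ 2 := by
    rw [variance_eq_sub (memLp_condExp_indicator_le hY y), integral_condExp hm,
      integral_indicator (measurableSet_le measurable_const hY)]
    simp
  simp_rw [h]
  have hanti : Antitone fun y => P.real {ω | y ≤ Y ω} := fun y z hyz =>
    measureReal_mono fun ω hω => hyz.trans hω
  exact (antitone_integral_condExp_indicator_sq hY).measurable.sub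
    (hanti.measurable.pow_const 2)

lemma integrable_variance_condExp_indicator (hm : m ≤ mΩ) (hY : Measurable Y) :
    Integrable (fun y =>
      variance (P[Set.indicator {ω | y ≤ Y ω} (fun _ => (1 : ℝ)) | m]) P) (P.map Y) := by
  have := Measure.isProbabilityMeasure_map (μ := P) hY.aemeasurable
  refine Integrable.of_bound (measurable_variance_condExp_indicator hm hY).aestronglyMeasurable 1
    (ae_of_all _ fun y => ?_)
  rw [Real.norm_of_nonneg (variance_nonneg _ _)]
  refine (variance_condExp_indicator_le hm hY y).trans ?_
  refine (variance_le_expectation_sq (memLp_indicator_le hY y 2).aestronglyMeasurable).trans ?_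
  refine (integral_mono (memLp_indicator_le hY y 2).integrable_sq (integrable_const 1)
    fun ω => ?_).trans (by simp)
  by_cases h : y ≤ Y ω <;> simp [h]

lemma integrable_variance_indicator (hY : Measurable Y) :
    Integrable (fun y =>
      variance (Set.indicator {ω | y ≤ Y ω} (fun _ => (1 : ℝ))) P) (P.map Y) := by
  convert integrable_variance_condExp_indicator (P := P) le_rfl hY using 3 with y
  rw [condExp_of_stronglyMeasurable le_rfl _ ((memLp_indicator_le hY y 1).integrable le_rfl)]
  exact stronglyMeasurable_const.indicator (measurableSet_le measurable_const hY)

omit [IsProbabilityMeasure P] in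
lemma eventuallyMeasurable_of_dense {s : Set ℝ} (hs : Dense s)
    (h : ∀ y ∈ s, EventuallyMeasurableSet m (ae P) {ω | y ≤ Y ω}) :
    EventuallyMeasurable m (ae P) Y := by
  have hgen : Real.measurableSpace = MeasurableSpace.generateFrom
      {S : Set ℝ | ∃ l ∈ s, ∃ u ∈ s, l < u ∧ Set.Ico l u = S} :=
    (BorelSpace.measurable_eq).trans hs.borel_eq_generateFrom_Ico_mem
  rw [EventuallyMeasurable, hgen]
  refine @measurable_generateFrom _ _ (eventuallyMeasurableSpace m (ae P)) _ _ ?_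
  rintro _ ⟨l, hl, u, hu, -, rfl⟩
  rw [← Set.Ici_sdiff_Ici]
  exact @MeasurableSet.diff _ (eventuallyMeasurableSpace m (ae P)) _ _ (h l hl) (h u hu)

lemma integral_variance_condExp_eq_iff (hm : m ≤ mΩ) (hY : Measurable Y)
    (hac : volume ≪ P.map Y) :
    (∫ y, variance (P[Set.indicator {ω | y ≤ Y ω} (fun _ => (1 : ℝ)) | m]) P ∂(P.map Y)) =
      (∫ y, variance (Set.indicator {ω | y ≤ Y ω} (fun _ => (1 : ℝ))) P ∂(P.map Y)) ↔
    EventuallyMeasurable m (ae P) Y := by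
  rw [integral_eq_iff_of_ae_le (integrable_variance_condExp_indicator hm hY)
    (integrable_variance_indicator hY) (ae_of_all _ (variance_condExp_indicator_le hm hY))]
  refine ⟨fun h => ?_, fun h => ae_of_all _ fun y => ?_⟩
  · exact eventuallyMeasurable_of_dense (Measure.dense_of_ae (hac.ae_le h)) fun y hy =>
      (variance_condExp_indicator_eq_iff hm hY y).1 hy
  · exact (variance_condExp_indicator_eq_iff hm hY y).2 (h measurableSet_Ici)

lemma variance_eq_zero_of_indep_of_eventuallyMeasurable (hY : Measurable Y)
    (hYm : EventuallyMeasurable m (ae P) Y)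
    (hind : Indep (MeasurableSpace.comap Y inferInstance) m P) : variance Y P = 0 := by
  by_cases hmem : MemLp Y 2 P
  · have hself : IndepFun Y Y P := by
      rw [IndepFun_iff]
      rintro s _ hs ⟨B, hB, rfl⟩
      obtain ⟨t, ht, hBt⟩ := hYm hB
      have hinter : (s ∩ Y ⁻¹' B : Set Ω) =ᵐ[P] (s ∩ t : Set Ω) := (ae_eq_refl s).inter hBt
      rw [measure_congr hBt, measure_congr hinter]
      exact (Indep_iff _ _ _).1 hind _ _ hs ht
    rw [← covariance_self hY.aemeasurable]
    exact hself.covariance_eq_zero hmem hmem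
  · exact variance_of_not_memLp hY.aestronglyMeasurable hmem

lemma variance_eq_zero_of_eventuallyMeasurable_bot (hY : Measurable Y)
    (h : EventuallyMeasurable ⊥ (ae P) Y) : variance Y P = 0 :=
  variance_eq_zero_of_indep_of_eventuallyMeasurable hY h (indep_bot_right _)

lemma integral_variance_condExp_bot :
    (∫ y, variance (P[Set.indicator {ω | y ≤ Y ω} (fun _ => (1 : ℝ)) | ⊥]) P ∂(P.map Y)) = 0 := by
  simp [condExp_bot, variance_eq_integral aemeasurable_const]

lemma xiSigma_bot : xiSigma ⊥ P Y = 0 := by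
  rw [xiSigma, integral_variance_condExp_bot, zero_div]

lemma integral_variance_indicator_pos (hY : Measurable Y)
    (hac : volume ≪ P.map Y) (hvar : variance Y P ≠ 0) :
    0 < ∫ y, variance (Set.indicator {ω | y ≤ Y ω} (fun _ => (1 : ℝ))) P ∂(P.map Y) := by
  refine (integral_nonneg fun y => variance_nonneg _ _).lt_of_ne fun h => hvar ?_
  refine variance_eq_zero_of_eventuallyMeasurable_bot hY
    ((integral_variance_condExp_eq_iff bot_le hY hac).1 ?_)
  rw [integral_variance_condExp_bot, ← h]

lemma xiSigma_le_one (hm : m ≤ mΩ) (hY : Measurable Y) : xiSigma m P Y ≤ 1 :=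
  div_le_one_of_le₀ (integral_mono (integrable_variance_condExp_indicator hm hY)
    (integrable_variance_indicator hY) (variance_condExp_indicator_le hm hY))
    (integral_nonneg fun _ => variance_nonneg _ _)

lemma xiSigma_eq_one_iff (hm : m ≤ mΩ) (hY : Measurable Y)
    (hac : volume ≪ P.map Y) (hvar : variance Y P ≠ 0) :
    xiSigma m P Y = 1 ↔ EventuallyMeasurable m (ae P) Y := by
  rw [xiSigma, div_eq_one_iff_eq (integral_variance_indicator_pos hY hac hvar).ne',
    integral_variance_condExp_eq_iff hm hY hac]

end RankCorrelation

section PosSemidefMatrix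

open Matrix

open scoped MatrixOrder Matrix.Norms.L2Operator in
lemma Matrix.PosSemidef.exists_eq_conjTranspose_mul_self {n : ℕ}
    {S : Matrix (Fin n) (Fin n) ℝ} (hS : S.PosSemidef) :
    ∃ B : Matrix (Fin n) (Fin n) ℝ, S = Bᴴ * B :=
  CStarAlgebra.nonneg_iff_eq_star_mul_self.mp hS.nonneg

lemma Matrix.PosSemidef.exists_normal_equations {n : ℕ} {S : Matrix (Fin n) (Fin n) ℝ}
    (hS : S.PosSemidef) (A : Set (Fin n)) (v : Fin n → ℝ) :
    ∃ u : Fin n → ℝ, (∀ k, k ∉ A → u k = 0) ∧ ∀ k ∈ A, (S *ᵥ (v - u)) k = 0 := by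
  obtain ⟨B, rfl⟩ := hS.exists_eq_conjTranspose_mul_self
  set D : Matrix (Fin n) (Fin n) ℝ := diagonal (A.indicator 1) with hD
  have hDT : Dᴴ = D := by simp [hD]
  have hrange : LinearMap.range ((B * D)ᴴ * (B * D)).mulVecLin =
      LinearMap.range ((B * D)ᴴ).mulVecLin := by
    refine Submodule.eq_of_le_of_finrank_eq ?_ ?_
    · rw [mulVecLin_mul]
      exact LinearMap.range_comp_le_range _ _
    · change ((B * D)ᴴ * (B * D)).rank = ((B * D)ᴴ).rank
      rw [rank_conjTranspose_mul_self, rank_conjTranspose]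
  have hmem : (B * D)ᴴ *ᵥ (B *ᵥ v) ∈ LinearMap.range ((B * D)ᴴ * (B * D)).mulVecLin := by
    rw [hrange]
    exact ⟨B *ᵥ v, rfl⟩
  obtain ⟨w, hw⟩ := hmem
  refine ⟨D *ᵥ w, fun k hk => by simp [hD, mulVec_diagonal, hk], fun k hk => ?_⟩
  have hzero : D *ᵥ ((Bᴴ * B) *ᵥ (v - D *ᵥ w)) = 0 := by
    rw [mulVecLin_apply, conjTranspose_mul, hDT] at hw
    simp only [mulVec_sub, mulVec_mulVec, Matrix.mul_assoc] at hw ⊢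
    rw [hw, sub_self]
  simpa [hD, mulVec_diagonal, hk] using congrFun hzero k

lemma Matrix.PosSemidef.rank_eq_rank_submatrix_castAdd_iff {p q : ℕ}
    {S : Matrix (Fin (p + q)) (Fin (p + q)) ℝ} (hS : S.PosSemidef) :
    S.rank = (S.submatrix (Fin.castAdd q) (Fin.castAdd q)).rank ↔
      ∀ j : Fin q, ∃ u : Fin (p + q) → ℝ, (∀ k, u (Fin.natAdd p k) = 0) ∧
        S *ᵥ (Pi.single (Fin.natAdd p j) 1 - u) = 0 := by
  obtain ⟨B, rfl⟩ := hS.exists_eq_conjTranspose_mul_self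
  set C : Matrix (Fin (p + q)) (Fin p) ℝ := B.submatrix id (Fin.castAdd q) with hC
  have hsub : (Bᴴ * B).submatrix (Fin.castAdd q) (Fin.castAdd q) = Cᴴ * C := by
    ext i j
    simp [hC, mul_apply]
  have hB (u : Fin (p + q) → ℝ) (hu : ∀ k, u (Fin.natAdd p k) = 0) :
      B *ᵥ u = C *ᵥ (fun i => u (Fin.castAdd q i)) := by
    ext i
    simp [hC, mulVec, dotProduct, Fin.sum_univ_add, hu]
  have hle : LinearMap.range C.mulVecLin ≤ LinearMap.range B.mulVecLin := by
    rintro _ ⟨u, rfl⟩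
    refine ⟨Fin.append u 0, ?_⟩
    rw [mulVecLin_apply, hB _ (by simp)]
    simp
  have hrank : B.rank = C.rank ↔ LinearMap.range C.mulVecLin = LinearMap.range B.mulVecLin :=
    ⟨fun h => Submodule.eq_of_le_of_finrank_eq hle h.symm, fun h => by rw [rank, rank, h]⟩
  rw [hsub, rank_conjTranspose_mul_self, rank_conjTranspose_mul_self, hrank]
  simp only [conjTranspose_mul_self_mulVec_eq_zero]
  simp only [mulVec_sub, sub_eq_zero]
  constructor
  · intro h j
    have hmem : B *ᵥ Pi.single (Fin.natAdd p j) 1 ∈ LinearMap.range C.mulVecLin := by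
      rw [h]
      exact ⟨_, rfl⟩
    obtain ⟨w, hw⟩ := hmem
    refine ⟨Fin.append w 0, by simp, ?_⟩
    rw [← hw, hB _ (by simp)]
    simp
  · intro h
    refine le_antisymm hle ?_
    rw [range_mulVecLin, Submodule.span_le]
    rintro _ ⟨k, rfl⟩
    rw [← mulVec_single_one]
    refine Fin.addCases (fun i => ?_) (fun j => ?_) k
    · refine ⟨Pi.single i 1, ?_⟩
      simp [hC]
      rfl
    · obtain ⟨u, hu, huB⟩ := h j
      rw [huB, hB u hu]
      exact ⟨_, rfl⟩

end PosSemidefMatrix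

section GaussianVec

open Matrix

variable {Ω : Type*} [mΩ : MeasurableSpace Ω] {P : Measure Ω} {n : ℕ}
  {W : Ω → (Fin n → ℝ)} {m : Fin n → ℝ} {S : Matrix (Fin n) (Fin n) ℝ}

lemma IsGaussianVec.hasGaussianLaw (h : IsGaussianVec P W m S) (hW : Measurable W) :
    HasGaussianLaw W P where
  isGaussian_map := by
    refine isGaussian_of_map_eq_gaussianReal fun L => ⟨∑ i, L (Pi.single i 1) * m i,
      Real.toNNReal ((fun i => L (Pi.single i 1)) ⬝ᵥ S *ᵥ fun i => L (Pi.single i 1)), ?_⟩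
    rw [← h fun i => L (Pi.single i 1), Measure.map_map (by fun_prop) hW]
    congr 1
    ext ω
    have hsingle (i : Fin n) : (Pi.single i 1 : Fin n → ℝ) = fun j => if i = j then 1 else 0 := by
      ext j
      simp [Pi.single_apply, eq_comm]
    simpa [mul_comm, hsingle] using LinearMap.pi_apply_eq_sum_univ L.toLinearMap (W ω)

lemma IsGaussianVec.memLp_linear (h : IsGaussianVec P W m S) (hW : Measurable W)
    (a : Fin n → ℝ) : MemLp (fun ω => ∑ i, a i * W ω i) 2 P :=
  memLp_finsetSum _ fun i _ => ((h.hasGaussianLaw hW).eval i).memLp_two.const_mul (a i)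

lemma IsGaussianVec.variance_linear (h : IsGaussianVec P W m S) (hW : Measurable W)
    (hS : S.PosSemidef) (a : Fin n → ℝ) :
    variance (fun ω => ∑ i, a i * W ω i) P = a ⬝ᵥ S *ᵥ a := by
  have hnonneg : 0 ≤ a ⬝ᵥ S *ᵥ a := by simpa using hS.dotProduct_mulVec_nonneg a
  have hmeas : Measurable fun ω => ∑ i, a i * W ω i := by fun_prop
  have hid := variance_map (μ := P) aemeasurable_id hmeas.aemeasurable
  rw [h a, variance_id_gaussianReal, Real.coe_toNNReal _ hnonneg] at hid
  exact hid.symm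

lemma IsGaussianVec.covariance_linear (h : IsGaussianVec P W m S) (hW : Measurable W)
    (hS : S.PosSemidef) (a b : Fin n → ℝ) :
    covariance (fun ω => ∑ i, a i * W ω i) (fun ω => ∑ i, b i * W ω i) P = a ⬝ᵥ S *ᵥ b := by
  have := (h.hasGaussianLaw hW).isProbabilityMeasure
  have hadd := variance_add (h.memLp_linear hW a) (h.memLp_linear hW b)
  have hsum : ((fun ω => ∑ i, a i * W ω i) + fun ω => ∑ i, b i * W ω i) =
      fun ω => ∑ i, (a + b) i * W ω i := by
    ext ω
    simp [add_mul, Finset.sum_add_distrib]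
  have hsymm : b ⬝ᵥ S *ᵥ a = a ⬝ᵥ S *ᵥ b := by
    have hST : Sᵀ = S := hS.isHermitian
    rw [dotProduct_mulVec, ← mulVec_transpose, hST, dotProduct_comm]
  rw [hsum, h.variance_linear hW hS, h.variance_linear hW hS, h.variance_linear hW hS,
    mulVec_add, add_dotProduct, dotProduct_add, dotProduct_add, hsymm] at hadd
  linarith

lemma IsGaussianVec.indepFun_linear (h : IsGaussianVec P W m S) (hW : Measurable W)
    (hS : S.PosSemidef) (A : Set (Fin n)) (a : Fin n → ℝ) (ha : ∀ k ∈ A, (S *ᵥ a) k = 0) :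
    IndepFun (fun ω => ∑ i, a i * W ω i) (fun ω (k : A) => W ω k) P := by
  let := Fintype.ofFinite A
  let L : (Fin n → ℝ) →L[ℝ] (Unit → ℝ) × (A → ℝ) :=
    (ContinuousLinearMap.pi fun _ => ∑ i, a i • ContinuousLinearMap.proj i).prod
      (ContinuousLinearMap.pi fun k : A => ContinuousLinearMap.proj (k : Fin n))
  have hL : HasGaussianLaw (fun ω => (fun _ : Unit => ∑ i, a i * W ω i, fun k : A => W ω k)) P := by
    have hLW : (fun ω => (fun _ : Unit => ∑ i, a i * W ω i, fun k : A => W ω k)) =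
        fun ω => L (W ω) := by
      ext ω k <;> simp [L, _root_.sum_apply]
    rw [hLW]
    exact (h.hasGaussianLaw hW).map_fun L
  have hind := hL.indepFun_of_covariance_eval (X := fun (_ : Unit) ω => ∑ i, a i * W ω i)
    (Y := fun (k : A) ω => W ω k) fun _ k => by
      have hk : (fun ω => W ω k) = fun ω => ∑ i, (Pi.single (k : Fin n) 1 : Fin n → ℝ) i * W ω i := by
        ext ω
        simp [Pi.single_apply]
      have := (h.hasGaussianLaw hW).isProbabilityMeasure
      rw [hk, covariance_comm, h.covariance_linear hW hS, single_one_dotProduct, ha k k.2]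
  exact hind.comp (measurable_pi_apply ()) measurable_id

/-- The σ-algebra generated by the coordinates of `W` with index in `A`. -/
abbrev coordinateSigma {Ω : Type*} {n : ℕ} (W : Ω → (Fin n → ℝ)) (A : Set (Fin n)) :
    MeasurableSpace Ω :=
  MeasurableSpace.comap (fun ω (k : A) => W ω k) inferInstance

omit mΩ in
lemma measurable_coordinateSigma_linear {A : Set (Fin n)} {u : Fin n → ℝ}
    (hu : ∀ k, k ∉ A → u k = 0) : Measurable[coordinateSigma W A] fun ω => ∑ i, u i * W ω i := by
  let := coordinateSigma W A
  refine Finset.measurable_sum _ fun i _ => ?_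
  by_cases hi : i ∈ A
  · have hWi : Measurable fun ω => W ω i :=
      (measurable_pi_apply (⟨i, hi⟩ : A)).comp (comap_measurable fun ω (k : A) => W ω k)
    exact hWi.const_mul (u i)
  · simp [hu i hi]

lemma IsGaussianVec.eventuallyMeasurable_linear_iff (h : IsGaussianVec P W m S)
    (hW : Measurable W) (hS : S.PosSemidef) (A : Set (Fin n)) (v : Fin n → ℝ) :
    EventuallyMeasurable (coordinateSigma W A) (ae P)
      (fun ω => ∑ i, v i * W ω i) ↔
    ∃ u : Fin n → ℝ, (∀ k, k ∉ A → u k = 0) ∧ S *ᵥ (v - u) = 0 := by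
  have := (h.hasGaussianLaw hW).isProbabilityMeasure
  have hsub (u : Fin n → ℝ) (ω : Ω) :
      ∑ i, (v - u) i * W ω i = (∑ i, v i * W ω i) - ∑ i, u i * W ω i := by
    simp [sub_mul, Finset.sum_sub_distrib]
  constructor
  · intro hv
    obtain ⟨u, hu, hSu⟩ := hS.exists_normal_equations A v
    refine ⟨u, hu, ?_⟩
    have hR : EventuallyMeasurable (coordinateSigma W A) (ae P) fun ω => ∑ i, (v - u) i * W ω i := by
      simp only [hsub]
      exact Measurable.sub (m := eventuallyMeasurableSpace (coordinateSigma W A) (ae P)) hv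
        (measurable_coordinateSigma_linear hu).eventuallyMeasurable
    have hzero := variance_eq_zero_of_indep_of_eventuallyMeasurable (by fun_prop) hR
      ((IndepFun_iff_Indep _ _ _).1 (h.indepFun_linear hW hS A (v - u) hSu))
    rw [h.variance_linear hW hS] at hzero
    exact (hS.dotProduct_mulVec_zero_iff (v - u)).1 (by simpa using hzero)
  · rintro ⟨u, hu, hSu⟩
    have hconst := ae_eq_integral_of_variance_eq_zero (h.memLp_linear hW (v - u))
      (by rw [h.variance_linear hW hS, hSu, dotProduct_zero])
    refine ((measurable_coordinateSigma_linear hu).add_const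
      (∫ ω, ∑ i, (v - u) i * W ω i ∂P)).eventuallyMeasurable_of_eventuallyEq ?_
    filter_upwards [hconst] with ω hω
    rw [← hω, hsub]
    ring

end GaussianVec

lemma Fin.castAdd_lt_natAdd {p q : ℕ} (k : Fin p) (i : Fin q) :
    Fin.castAdd q k < Fin.natAdd p i :=
  Fin.lt_def.2 (k.isLt.trans_le (Nat.le_add_right p i))

section ResponseVector

variable {Ω : Type*} {p q : ℕ} {X : Ω → (Fin p → ℝ)} {Y : Fin q → Ω → ℝ}

lemma comap_sup_sigmaPast_eq_coordinateSigma (X : Ω → (Fin p → ℝ)) (Y : Fin q → Ω → ℝ)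
    (i : Fin q) :
    MeasurableSpace.comap X inferInstance ⊔ sigmaPast Y i =
      coordinateSigma (fun ω => Fin.append (X ω) (fun j => Y j ω)) {k | k < Fin.natAdd p i} := by
  let W : Ω → (Fin (p + q) → ℝ) := fun ω => Fin.append (X ω) (fun j => Y j ω)
  let A : Set (Fin (p + q)) := {k | k < Fin.natAdd p i}
  have hcoord (k : Fin (p + q)) (hk : k ∈ A) : Measurable[coordinateSigma W A] fun ω => W ω k :=
    (measurable_pi_apply (⟨k, hk⟩ : A)).comp (comap_measurable fun ω (k : A) => W ω k)
  refine le_antisymm (sup_le ?_ (iSup₂_le fun j hj => ?_)) (Measurable.comap_le ?_)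
  · refine Measurable.comap_le (@measurable_pi_lambda _ _ _ (coordinateSigma W A) _ _ fun k => ?_)
    simpa [W] using hcoord (Fin.castAdd q k) (Fin.castAdd_lt_natAdd k i)
  · refine Measurable.comap_le ?_
    simpa [W] using hcoord (Fin.natAdd p j) ((Fin.natAdd_lt_natAdd_iff p).2 hj)
  · refine @measurable_pi_lambda _ _ _ (_) _ _ fun ⟨k, hk⟩ => ?_
    induction k using Fin.addCases with
    | left k =>
      simp only [Fin.append_left]
      exact Measurable.mono ((measurable_pi_apply k).comp (comap_measurable X)) le_sup_left le_rfl
    | right j =>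
      simp only [Fin.append_right]
      have hj : j < i := (Fin.natAdd_lt_natAdd_iff p).1 hk
      exact Measurable.mono (comap_measurable (Y j))
        (le_sup_of_le_right (le_iSup₂_of_le j hj le_rfl)) le_rfl

lemma sigmaPast_le [mΩ : MeasurableSpace Ω] (hY : ∀ i, Measurable (Y i)) (i : Fin q) :
    sigmaPast Y i ≤ mΩ :=
  iSup₂_le fun j _ => (hY j).comap_le

lemma measurable_append [MeasurableSpace Ω] (hX : Measurable X) (hY : ∀ i, Measurable (Y i)) :
    Measurable fun ω => Fin.append (X ω) (fun j => Y j ω) := by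
  refine measurable_pi_lambda _ fun k => ?_
  induction k using Fin.addCases with
  | left k => simpa using measurable_pi_iff.1 hX k
  | right j => simpa using hY j

/-- The denominator of `1 - T(Y|X)` vanishes only if there is no response variable. -/
lemma card_sub_sum_xiSigma_sigmaPast_pos [MeasurableSpace Ω] {P : Measure Ω}
    [IsProbabilityMeasure P] (hY : ∀ i, Measurable (Y i)) (hq : 0 < q) :
    0 < (q : ℝ) - ∑ i, xiSigma (sigmaPast Y i) P (Y i) := by
  have hfirst : sigmaPast Y ⟨0, hq⟩ = ⊥ := by
    simp [sigmaPast, Fin.lt_def]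
  have hlt : ∑ i, xiSigma (sigmaPast Y i) P (Y i) < ∑ _i : Fin q, (1 : ℝ) := by
    refine Finset.sum_lt_sum (fun i _ => xiSigma_le_one (sigmaPast_le hY i) (hY i))
      ⟨⟨0, hq⟩, Finset.mem_univ _, ?_⟩
    rw [hfirst, xiSigma_bot]
    exact one_pos
  simpa using hlt

lemma T_eq_one_iff [MeasurableSpace Ω] {P : Measure Ω} [IsProbabilityMeasure P]
    (hX : Measurable X) (hY : ∀ i, Measurable (Y i)) :
    T P Y X = 1 ↔
      ∀ i, xiSigma (MeasurableSpace.comap X inferInstance ⊔ sigmaPast Y i) P (Y i) = 1 := by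
  rcases Nat.eq_zero_or_pos q with rfl | hq
  · simp [T]
  have hsum : (q : ℝ) - ∑ i, xiSigma (MeasurableSpace.comap X inferInstance ⊔ sigmaPast Y i) P (Y i)
      = ∑ i, (1 - xiSigma (MeasurableSpace.comap X inferInstance ⊔ sigmaPast Y i) P (Y i)) := by
    simp
  rw [T, sub_eq_self, div_eq_zero_iff,
    or_iff_left (card_sub_sum_xiSigma_sigmaPast_pos hY hq).ne', hsum,
    Finset.sum_eq_zero_iff_of_nonneg fun i _ => sub_nonneg.2 <|
      xiSigma_le_one (sup_le hX.comap_le (sigmaPast_le hY i)) (hY i)]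
  simp only [Finset.mem_univ, true_imp_iff, sub_eq_zero]
  exact forall_congr' fun i => eq_comm

end ResponseVector

open Matrix in
/-- Successive linear dependence of the last `q` columns on all previous columns is the same as
linear dependence of these columns on the first `p` columns. -/
lemma Matrix.forall_exists_mulVec_single_sub_iff {p q : ℕ}
    (S : Matrix (Fin (p + q)) (Fin (p + q)) ℝ) :
    (∀ i : Fin q, ∃ u : Fin (p + q) → ℝ, (∀ k, ¬ k < Fin.natAdd p i → u k = 0) ∧
      S *ᵥ (Pi.single (Fin.natAdd p i) 1 - u) = 0) ↔
    ∀ i : Fin q, ∃ u : Fin (p + q) → ℝ, (∀ k : Fin q, u (Fin.natAdd p k) = 0) ∧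
      S *ᵥ (Pi.single (Fin.natAdd p i) 1 - u) = 0 := by
  constructor
  · intro h
    let V : Submodule ℝ (Fin (p + q) → ℝ) :=
      { carrier := {u | ∀ k : Fin q, u (Fin.natAdd p k) = 0}
        add_mem' := fun ha hb k => by simp [ha k, hb k]
        zero_mem' := fun _ => rfl
        smul_mem' := fun c u hu k => by simp [hu k] }
    let K := V ⊔ LinearMap.ker S.mulVecLin
    have hK (v : Fin (p + q) → ℝ) : v ∈ K ↔ ∃ u ∈ V, S *ᵥ (v - u) = 0 := by
      simp only [K, Submodule.mem_sup, LinearMap.mem_ker, mulVecLin_apply]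
      exact exists_congr fun u => and_congr_right fun _ =>
        ⟨fun ⟨z, hz, huz⟩ => by simp [← huz, hz], fun hz => ⟨v - u, hz, by simp⟩⟩
    intro i
    refine (hK _).1 ?_
    induction i using WellFoundedLT.induction with
    | ind i ih =>
      obtain ⟨u, hu, hSu⟩ := h i
      have huK : u ∈ K := by
        rw [pi_eq_sum_univ' u]
        refine Submodule.sum_mem _ fun k _ => ?_
        by_cases hk : k < Fin.natAdd p i
        · refine Submodule.smul_mem _ _ ?_
          induction k using Fin.addCases with
          | left k =>
            refine Submodule.mem_sup_left fun j => ?_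
            have : Fin.castAdd q k ≠ Fin.natAdd p j := (Fin.castAdd_lt_natAdd k j).ne
            simp [this.symm]
          | right j =>
            convert ih j ((Fin.natAdd_lt_natAdd_iff p).1 hk) using 1
        · simp [hu k hk]
      have hsub : Pi.single (Fin.natAdd p i) 1 - u ∈ K := Submodule.mem_sup_right hSu
      simpa using K.add_mem hsub huK
  · refine fun h i => (h i).imp fun u ⟨hu, hSu⟩ => ⟨fun k hk => ?_, hSu⟩
    induction k using Fin.addCases with
    | left k => exact absurd (Fin.castAdd_lt_natAdd k i) hk
    | right j => exact hu j

lemma volume_absolutelyContinuous_map_of_nondegenerate {Ω : Type*} [MeasurableSpace Ω]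
    {P : Measure Ω} {Y : Ω → ℝ} (hY : HasGaussianLaw Y P) (hvar : variance Y P ≠ 0) :
    volume ≪ P.map Y := by
  rw [hY.map_eq_gaussianReal]
  exact gaussianReal_absolutelyContinuous' _
    (Real.toNNReal_pos.2 ((variance_nonneg Y P).lt_of_ne' hvar)).ne'

theorem T_gaussian_eq_one_iff_rank
    {Ω : Type*} [MeasurableSpace Ω] (P : Measure Ω) [IsProbabilityMeasure P]
    {p q : ℕ} (X : Ω → (Fin p → ℝ)) (Y : Fin q → Ω → ℝ)
    (hX : Measurable X) (hY : ∀ i, Measurable (Y i))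
    (hnd : ∀ i, Nondegenerate P (Y i))
    (m : Fin (p + q) → ℝ) (S : Matrix (Fin (p + q)) (Fin (p + q)) ℝ) (hS : S.PosSemidef)
    (hGauss : IsGaussianVec P (fun ω => Fin.append (X ω) (fun j => Y j ω)) m S) :
    T P Y X = 1 ↔
      S.rank = (S.submatrix (Fin.castAdd q) (Fin.castAdd q)).rank := by
  let W : Ω → (Fin (p + q) → ℝ) := fun ω => Fin.append (X ω) (fun j => Y j ω)
  have hW : Measurable W := measurable_append hX hY
  rw [T_eq_one_iff hX hY, hS.rank_eq_rank_submatrix_castAdd_iff,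
    ← Matrix.forall_exists_mulVec_single_sub_iff]
  refine forall_congr' fun i => ?_
  have hlinear : Y i =
      fun ω => ∑ k, (Pi.single (Fin.natAdd p i) 1 : Fin (p + q) → ℝ) k * W ω k := by
    ext ω
    simp [W, Pi.single_apply]
  have hlaw : HasGaussianLaw (Y i) P := by
    simpa [W] using (hGauss.hasGaussianLaw hW).eval (Fin.natAdd p i)
  have hvar : variance (Y i) P ≠ 0 := fun h0 =>
    hnd i ⟨_, ae_eq_integral_of_variance_eq_zero hlaw.memLp_two h0⟩
  rw [xiSigma_eq_one_iff (sup_le hX.comap_le (sigmaPast_le hY i)) (hY i)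
    (volume_absolutelyContinuous_map_of_nondegenerate hlaw hvar) hvar,
    comap_sup_sigmaPast_eq_coordinateSigma, hlinear]
  exact hGauss.eventuallyMeasurable_linear_iff hW hS _ _
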